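/- Williamson's theorem: let M be a 2n×2n real symmetric positive definite matrix. Then there exist a real symplectic matrix S (i.e., S·J·Sᵀ = J with J the standard symplectic form) and positive real numbers μ₁ ≥ … ≥ μₙ > 0 such that S·M·Sᵀ = Diag(μ₁,…,μₙ,μ₁,…,μₙ). -/

import Mathlib

open Matrix

/-- The `2n × 2n` standard symplectic form `J = [[0, Iₙ], [−Iₙ, 0]]`. -/
noncomputable def symplecticJ (n : ℕ) : Matrix (Fin n ⊕ Fin n) (Fin n ⊕ Fin n) ℝ :=
  Matrix.fromBlocks 0 1 (-1) 0

open scoped InnerProductSpace in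
/-- An invariant nontrivial subspace of a skew operator contains a normal-form pair. -/
lemma skew_pair {E : Type*} [NormedAddCommGroup E] [InnerProductSpace ℝ E]
    [FiniteDimensional ℝ E] (A : E →ₗ[ℝ] E) (hA : ∀ x y, ⟪A x, y⟫_ℝ = -⟪x, A y⟫_ℝ)
    (hinj : ∀ x, A x = 0 → x = 0) (K : Submodule ℝ E) (hK : ∀ x ∈ K, A x ∈ K) (hne : K ≠ ⊥) :
    ∃ (e f : E) (l : ℝ), e ∈ K ∧ f ∈ K ∧ ⟪e, e⟫_ℝ = 1 ∧ ⟪f, f⟫_ℝ = 1 ∧ ⟪e, f⟫_ℝ = 0 ∧ 0 < l ∧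
      A e = -l • f ∧ A f = l • e := by
  have hK2 : ∀ x ∈ K, (A ∘ₗ A) x ∈ K := fun x hx => hK _ (hK _ hx)
  have hsymm : (A ∘ₗ A).IsSymmetric := by
    intro x y
    simp [hA]
  have hs := hsymm.restrict_invariant hK2
  have : Nontrivial K := (Submodule.nontrivial_iff_ne_bot).2 hne
  have hpos : 0 < Module.finrank ℝ K := Module.finrank_pos
  let b := hs.eigenvectorBasis rfl
  let i0 : Fin (Module.finrank ℝ K) := ⟨0, hpos⟩
  obtain ⟨c, hc⟩ : ∃ c : ℝ, A (A (b i0 : E)) = c • (b i0 : E) := by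
    refine ⟨hs.eigenvalues rfl i0, ?_⟩
    have := hs.apply_eigenvectorBasis rfl i0
    exact congrArg Subtype.val this
  obtain ⟨e, he⟩ : ∃ e : E, e = (b i0 : E) := ⟨_, rfl⟩
  have heK : e ∈ K := he ▸ (b i0).2
  rw [← he] at hc
  have he1 : ⟪e, e⟫_ℝ = 1 := by
    have h1 : ‖b i0‖ = 1 := b.orthonormal.1 i0
    have h2 : ‖e‖ = 1 := by rw [he]; exact h1
    rw [real_inner_self_eq_norm_sq, h2]; norm_num
  have hAe : A e ≠ 0 := by
    intro h
    have := hinj e h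
    rw [this] at he1
    simp at he1
  have hl : 0 < ‖A e‖ := norm_pos_iff.2 hAe
  have hcl : c = -‖A e‖ ^ 2 := by
    have := hA (A e) e
    rw [hc, inner_smul_left, he1, real_inner_self_eq_norm_sq] at this
    simpa using this
  have hz : ⟪e, A e⟫_ℝ = 0 := by
    have := hA e e
    rw [real_inner_comm] at this
    linarith
  refine ⟨e, -(‖A e‖⁻¹) • A e, ‖A e‖, heK, K.smul_mem _ (hK _ heK), he1, ?_, ?_, hl, ?_, ?_⟩
  · rw [inner_smul_left, inner_smul_right, real_inner_self_eq_norm_sq]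
    simp
    field_simp
  · rw [inner_smul_right, hz, mul_zero]
  · rw [smul_smul]
    field_simp
    simp
  · rw [map_smul, hc, smul_smul, hcl]
    congr 1
    field_simp

open scoped InnerProductSpace in
lemma skew_family {E : Type*} [NormedAddCommGroup E] [InnerProductSpace ℝ E]
    [FiniteDimensional ℝ E] (A : E →ₗ[ℝ] E) (hA : ∀ x y, ⟪A x, y⟫_ℝ = -⟪x, A y⟫_ℝ)
    (hinj : ∀ x, A x = 0 → x = 0) (k : ℕ) (hk : 2 * k ≤ Module.finrank ℝ E) :
    ∃ (e f : Fin k → E) (l : Fin k → ℝ),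
      (∀ i j, ⟪e i, e j⟫_ℝ = if i = j then 1 else 0) ∧
      (∀ i j, ⟪f i, f j⟫_ℝ = if i = j then 1 else 0) ∧
      (∀ i j, ⟪e i, f j⟫_ℝ = 0) ∧ (∀ i, 0 < l i) ∧
      (∀ i, A (e i) = -l i • f i) ∧ (∀ i, A (f i) = l i • e i) := by
  induction k with
  | zero =>
    exact ⟨Fin.elim0, Fin.elim0, Fin.elim0, fun i => i.elim0, fun i => i.elim0, fun i => i.elim0,
      fun i => i.elim0, fun i => i.elim0, fun i => i.elim0⟩
  | succ k ih =>
    obtain ⟨e, f, l, hee, hff, hef, hl, hAe, hAf⟩ := ih (by omega)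
    let W : Submodule ℝ E := Submodule.span ℝ (Set.range (Sum.elim e f))
    have hmem : ∀ x, x ∈ Wᗮ ↔ (∀ i, ⟪e i, x⟫_ℝ = 0) ∧ (∀ i, ⟪f i, x⟫_ℝ = 0) := by
      intro x
      constructor
      · intro hx
        rw [Submodule.mem_orthogonal] at hx
        exact ⟨fun i => hx _ (Submodule.subset_span ⟨Sum.inl i, rfl⟩),
          fun i => hx _ (Submodule.subset_span ⟨Sum.inr i, rfl⟩)⟩
      · rintro ⟨h1, h2⟩
        rw [Submodule.mem_orthogonal]
        intro u hu
        induction hu using Submodule.span_induction with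
        | mem u hu =>
          obtain ⟨i | i, rfl⟩ := hu
          · exact h1 i
          · exact h2 i
        | zero => simp
        | add a b _ _ ha hb => rw [inner_add_left, ha, hb, add_zero]
        | smul c a _ ha => rw [inner_smul_left, ha, mul_zero]
    have hinv : ∀ x ∈ Wᗮ, A x ∈ Wᗮ := by
      intro x hx
      rw [hmem] at hx ⊢
      constructor
      · intro i
        have := hA (e i) x
        rw [hAe, inner_smul_left, hx.2] at this
        linarith
      · intro i
        have := hA (f i) x
        rw [hAf, inner_smul_left, hx.1] at this
        linarith
    have hne : Wᗮ ≠ ⊥ := by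
      intro h
      have h1 := Submodule.finrank_add_finrank_orthogonal W
      have h2 : Module.finrank ℝ W ≤ Fintype.card (Fin k ⊕ Fin k) := finrank_range_le_card _
      rw [h] at h1
      simp at h1 h2
      omega
    obtain ⟨e0, f0, l0, he0, hf0, h1, h2, h3, h4, h5, h6⟩ := skew_pair A hA hinj Wᗮ hinv hne
    rw [hmem] at he0 hf0
    have he0' : ∀ i, ⟪e0, e i⟫_ℝ = 0 := fun i => by rw [real_inner_comm]; exact he0.1 i
    have he0'' : ∀ i, ⟪e0, f i⟫_ℝ = 0 := fun i => by rw [real_inner_comm]; exact he0.2 i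
    have hf0'' : ∀ i, ⟪f0, f i⟫_ℝ = 0 := fun i => by rw [real_inner_comm]; exact hf0.2 i
    refine ⟨Fin.cons e0 e, Fin.cons f0 f, Fin.cons l0 l, ?_, ?_, ?_, ?_, ?_, ?_⟩
    · intro i j
      refine Fin.cases ?_ (fun i => ?_) i <;> refine Fin.cases ?_ (fun j => ?_) j <;>
        simp [-inner_self_eq_norm_sq_to_K, h1, he0', he0.1, hee, Fin.succ_ne_zero, (Fin.succ_ne_zero _).symm]
    · intro i j
      refine Fin.cases ?_ (fun i => ?_) i <;> refine Fin.cases ?_ (fun j => ?_) j <;>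
        simp [-inner_self_eq_norm_sq_to_K, h2, hf0'', hf0.2, hff, Fin.succ_ne_zero, (Fin.succ_ne_zero _).symm]
    · intro i j
      refine Fin.cases ?_ (fun i => ?_) i <;> refine Fin.cases ?_ (fun j => ?_) j <;>
        simp [h3, he0'', hf0.1, hef]
    · intro i
      refine Fin.cases ?_ (fun i => ?_) i <;> simp [h4, hl]
    · intro i
      refine Fin.cases ?_ (fun i => ?_) i <;> simp [h5, hAe]
    · intro i
      refine Fin.cases ?_ (fun i => ?_) i <;> simp [h6, hAf]

/-- Orthogonal normal form of an invertible real skew-symmetric matrix. -/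
lemma skew_matrix (n : ℕ) (A : Matrix (Fin n ⊕ Fin n) (Fin n ⊕ Fin n) ℝ)
    (hA : Aᵀ = -A) (hu : IsUnit A) :
    ∃ (O : Matrix (Fin n ⊕ Fin n) (Fin n ⊕ Fin n) ℝ) (l : Fin n → ℝ),
      O * Oᵀ = 1 ∧ (∀ i, 0 < l i) ∧ Monotone l ∧
      O * A * Oᵀ = Matrix.fromBlocks 0 (diagonal l) (-diagonal l) 0 := by
  have hinner : ∀ x y : EuclideanSpace ℝ (Fin n ⊕ Fin n),
      inner ℝ x y = x.ofLp ⬝ᵥ y.ofLp := by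
    intro x y
    rw [EuclideanSpace.inner_eq_star_dotProduct, dotProduct_comm]
    simp
  have happ : ∀ x : EuclideanSpace ℝ (Fin n ⊕ Fin n),
      (A.toEuclideanLin x).ofLp = A *ᵥ x.ofLp := fun x => rfl
  obtain ⟨e, f, l, hee, hff, hef, hl, hAe, hAf⟩ := skew_family (A.toEuclideanLin)
    (by
      intro x y
      rw [hinner, hinner, happ, happ, dotProduct_mulVec, ← mulVec_transpose, hA, neg_mulVec,
        neg_dotProduct, neg_neg])
    (by
      intro x hx
      have h1 : A *ᵥ x.ofLp = 0 := by rw [← happ, hx]; rfl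
      have h2 := (Matrix.mulVec_injective_iff_isUnit.2 hu) (h1.trans (mulVec_zero A).symm)
      exact (WithLp.ofLp_injective 2) h2)
    n (by simp; omega)
  let σ := Tuple.sort l
  let v : Fin n ⊕ Fin n → EuclideanSpace ℝ (Fin n ⊕ Fin n) := Sum.elim (e ∘ σ) (f ∘ σ)
  have hfe : ∀ i j, inner ℝ (f i) (e j) = 0 := fun i j => by rw [real_inner_comm]; exact hef j i
  refine ⟨Matrix.of fun i j => v i j, l ∘ σ, ?_, fun i => hl _, Tuple.monotone_sort l, ?_⟩
  · ext i j
    have : ((Matrix.of fun i j => v i j) * (Matrix.of fun i j => v i j)ᵀ) i j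
        = inner ℝ (v i) (v j) := by
      rw [hinner]; rfl
    rw [this]
    rcases i with i | i <;> rcases j with j | j <;>
      simp [v, hee, hff, hef, hfe, Matrix.one_apply]
  · ext i j
    have : ((Matrix.of fun i j => v i j) * A * (Matrix.of fun i j => v i j)ᵀ) i j
        = inner ℝ (v i) (A.toEuclideanLin (v j)) := by
      rw [hinner, happ, Matrix.mul_assoc]; rfl
    rw [this]
    rcases i with i | i <;> rcases j with j | j <;>
      simp [v, hee, hff, hef, hfe, hAe, hAf, Matrix.diagonal_apply, inner_smul_right,
        inner_neg_right] <;> (try split_ifs) <;> simp_all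

open scoped MatrixOrder in
theorem williamson (n : ℕ) (M : Matrix (Fin n ⊕ Fin n) (Fin n ⊕ Fin n) ℝ)
    (hM : M.PosDef) :
    ∃ (S : Matrix (Fin n ⊕ Fin n) (Fin n ⊕ Fin n) ℝ) (μ : Fin n → ℝ),
      S * symplecticJ n * Sᵀ = symplecticJ n ∧ (∀ i, 0 < μ i) ∧ Antitone μ ∧
      S * M * Sᵀ = Matrix.diagonal (Sum.elim μ μ) := by
  obtain ⟨C, hC, hMC⟩ : ∃ C : Matrix (Fin n ⊕ Fin n) (Fin n ⊕ Fin n) ℝ,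
      IsUnit C ∧ C * M * Cᵀ = 1 := by
    obtain ⟨B, hB, hMB⟩ : ∃ B : Matrix (Fin n ⊕ Fin n) (Fin n ⊕ Fin n) ℝ,
      IsUnit B ∧ M = Bᵀ * B := by
      obtain ⟨B, hB⟩ := CStarAlgebra.nonneg_iff_eq_star_mul_self.mp hM.posSemidef.nonneg
      rw [star_eq_conjTranspose, conjTranspose_eq_transpose_of_trivial] at hB
      refine ⟨B, ?_, hB⟩
      have hu := hM.isUnit
      rw [hB, Matrix.isUnit_iff_isUnit_det, det_mul] at hu
      exact (Matrix.isUnit_iff_isUnit_det B).2 (isUnit_of_mul_isUnit_right hu)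
    have hd : IsUnit B.det := (Matrix.isUnit_iff_isUnit_det B).1 hB
    have hdt : IsUnit Bᵀ.det := by rwa [det_transpose]
    refine ⟨(Bᵀ)⁻¹, (Matrix.isUnit_nonsing_inv_iff).2 ((Matrix.isUnit_iff_isUnit_det _).2 hdt), ?_⟩
    rw [hMB, ← Matrix.mul_assoc, Matrix.nonsing_inv_mul _ hdt, Matrix.one_mul,
      ← transpose_nonsing_inv, transpose_transpose, Matrix.mul_nonsing_inv _ hd]
  have hJt : (symplecticJ n)ᵀ = -symplecticJ n := by
    simp [symplecticJ, fromBlocks_transpose, fromBlocks_neg]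
  have hJu : IsUnit (symplecticJ n) := by
    have h : symplecticJ n * (-symplecticJ n) = 1 := by
      simp [symplecticJ, fromBlocks_neg, fromBlocks_multiply, fromBlocks_one]
    exact IsUnit.of_mul_eq_one _ h
  obtain ⟨O, l, hO, hl, hmono, hOA⟩ := skew_matrix n (C * symplecticJ n * Cᵀ)
    (by simp [transpose_mul, hJt, Matrix.mul_assoc])
    ((hC.mul hJu).mul (by
      rw [Matrix.isUnit_iff_isUnit_det, det_transpose, ← Matrix.isUnit_iff_isUnit_det]; exact hC))
  let r : Fin n → ℝ := fun i => (Real.sqrt (l i))⁻¹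
  have hr : ∀ i, r i * r i = (l i)⁻¹ := fun i => by
    simp only [r]; rw [← mul_inv, Real.mul_self_sqrt (hl i).le]
  have hr2 : ∀ i, r i * l i * r i = 1 := fun i => by
    rw [mul_right_comm, hr, inv_mul_cancel₀ (hl i).ne']
  let D : Matrix (Fin n ⊕ Fin n) (Fin n ⊕ Fin n) ℝ :=
    fromBlocks (diagonal r) 0 0 (diagonal r)
  have hDt : Dᵀ = D := by simp [D, fromBlocks_transpose]
  refine ⟨D * O * C, fun i => (l i)⁻¹, ?_, fun i => inv_pos.2 (hl i), ?_, ?_⟩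
  · have : D * O * C * symplecticJ n * (D * O * C)ᵀ
        = D * (O * (C * symplecticJ n * Cᵀ) * Oᵀ) * D := by
      simp only [transpose_mul, hDt, Matrix.mul_assoc]
    rw [this, hOA]
    simp only [D, fromBlocks_multiply, symplecticJ, Matrix.mul_zero, Matrix.zero_mul, add_zero,
      zero_add, Matrix.mul_neg, Matrix.neg_mul, diagonal_mul_diagonal, hr2, diagonal_one, neg_zero]
  · intro i j hij
    exact inv_anti₀ (hl i) (hmono hij)
  · have : D * O * C * M * (D * O * C)ᵀ
        = D * (O * (C * M * Cᵀ) * Oᵀ) * D := by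
      simp only [transpose_mul, hDt, Matrix.mul_assoc]
    rw [this, hMC, Matrix.mul_one, hO, Matrix.mul_one]
    simp [D, fromBlocks_multiply, hr, fromBlocks_diagonal]
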